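/- arXiv:2105.04755 — 3 statements merged into one kernel-verified Lean document; each statement's English description precedes it below -/
import Mathlib

section
/- Let s > 0 and L > s be real numbers, let n ≥ 1, and consider the circle AddCircle L = ℝ/Lℤ with its quotient metric and Borel σ-algebra. Let μ_1, …, μ_n be finite Borel measures on AddCircle L that are nonatomic. A piece is a subset of AddCircle L that is either empty or closed and connected. For each agent i define MMS_i^{n+1} := sup over all s-separated families (P_1,…,P_{n+1}) of n+1 pieces of min_{1≤j≤n+1} μ_i(P_j). Then there exists an s-separated family (A_1,…,A_n) of n pieces such that μ_i(A_i) ≥ MMS_i^{n+1} for every i ∈ {1,…,n}. -/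
open MeasureTheory

/-- A piece of the circle cake: either empty, or closed and connected. -/
def IsCirclePiece {L : ℝ} (P : Set (AddCircle L)) : Prop :=
  P = ∅ ∨ (IsClosed P ∧ IsConnected P)

/-- A family of sets is `s`-separated if any two points of distinct members are at
distance at least `s`. -/
def IsSepFamily {L : ℝ} [Fact (0 < L)] {m : ℕ} (s : ℝ)
    (P : Fin m → Set (AddCircle L)) : Prop :=
  ∀ i j : Fin m, i ≠ j → ∀ x ∈ P i, ∀ y ∈ P j, s ≤ dist x y

/-- A real number whose residues modulo `L` all stay at distance at least `s` from `0` has norm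
at least `s` in the circle. -/
theorem le_norm_coe_addCircle {s L z : ℝ} (hs : 0 < s) (h₁ : s ≤ z) (h₂ : z ≤ L - s) :
    s ≤ ‖(z : AddCircle L)‖ := by
  rw [AddCircle.norm_eq, le_abs]
  generalize round (L⁻¹ * z) = k
  have hL : 0 < L := by linarith
  rcases le_or_gt k 0 with hk | hk
  · have : (k : ℝ) ≤ 0 := by exact_mod_cast hk
    left
    nlinarith
  · have : (1 : ℝ) ≤ k := by exact_mod_cast hk
    right
    nlinarith

theorem dist_coe_addCircle_le {L : ℝ} [Fact (0 < L)] (x y : ℝ) :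
    dist (x : AddCircle L) (y : AddCircle L) ≤ |x - y| := by
  rw [dist_eq_norm, ← AddCircle.coe_sub, ← Real.norm_eq_abs]
  exact QuotientAddGroup.norm_mk_le_norm

/-- Real points of `[s, L]` which are `s`-separated on the line stay so on the circle. -/
theorem le_dist_coe_addCircle {s L x y : ℝ} [Fact (0 < L)] (hs : 0 < s)
    (hx : s ≤ x) (hxy : x + s ≤ y) (hy : y ≤ L) :
    s ≤ dist (x : AddCircle L) (y : AddCircle L) := by
  rw [dist_comm, dist_eq_norm, ← AddCircle.coe_sub]
  exact le_norm_coe_addCircle hs (by linarith) (by linarith)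

theorem isClosedEmbedding_coe_Icc_addCircle {s L : ℝ} [Fact (0 < L)] (hs : 0 < s) :
    Topology.IsClosedEmbedding (fun x : Set.Icc s L => ((x : ℝ) : AddCircle L)) := by
  refine Continuous.isClosedEmbedding
    ((AddCircle.continuous_mk' L).comp continuous_subtype_val) ?_
  rintro ⟨x, hx⟩ ⟨y, hy⟩ h
  have hmem : ∀ z ∈ Set.Icc s L, z ∈ Set.Ioc 0 (0 + L) := fun z hz =>
    ⟨hs.trans_le hz.1, by simpa using hz.2⟩
  exact Subtype.ext ((AddCircle.coe_eq_coe_iff_of_mem_Ioc (hmem x hx) (hmem y hy)).1 h)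

/-- A nonempty closed connected set avoiding the open arc `(0, s)` is the image of a compact
interval contained in `[s, L]`. -/
theorem exists_eq_coe_image_Icc {s L : ℝ} [Fact (0 < L)] (hs : 0 < s)
    {P : Set (AddCircle L)} (hP : IsClosed P) (hPc : IsConnected P)
    (hdisj : ∀ x ∈ Set.Ioo 0 s, (x : AddCircle L) ∉ P) :
    ∃ a b : ℝ, s ≤ a ∧ a ≤ b ∧ b ≤ L ∧ P = (fun x : ℝ => (x : AddCircle L)) '' Set.Icc a b := by
  have hf := isClosedEmbedding_coe_Icc_addCircle (L := L) hs
  set f := fun x : Set.Icc s L => ((x : ℝ) : AddCircle L)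
  have hPimage : f '' (f ⁻¹' P) = P := by
    refine Set.image_preimage_eq_of_subset fun p hp => ?_
    obtain ⟨x, hx, rfl⟩ : ∃ x ∈ Set.Ioc (0 : ℝ) (0 + L), (x : AddCircle L) = p := by
      have := AddCircle.coe_image_Ioc_eq L 0
      exact this.ge (Set.mem_univ p)
    have hxs : s ≤ x := by
      by_contra! h
      exact hdisj x ⟨hx.1, h⟩ hp
    exact ⟨⟨x, hxs, by simpa using hx.2⟩, rfl⟩
  have hconn : IsPreconnected (f ⁻¹' P) := by
    rw [← hf.isInducing.isPreconnected_image, hPimage]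
    exact hPc.isPreconnected
  set Q : Set ℝ := Subtype.val '' (f ⁻¹' P) with hQ
  have hQP : (fun x : ℝ => (x : AddCircle L)) '' Q = P := by
    rw [hQ, Set.image_image]
    exact hPimage
  have hQconn : IsConnected Q := by
    refine ⟨?_, hconn.image _ continuous_subtype_val.continuousOn⟩
    rw [← hQP] at hPc
    exact hPc.nonempty.of_image
  have hQcomp : IsCompact Q :=
    ((hP.preimage hf.continuous).isCompact).image continuous_subtype_val
  have hQIcc := eq_Icc_of_connected_compact hQconn hQcomp
  have hsub : Q ⊆ Set.Icc s L := by
    rintro _ ⟨x, -, rfl⟩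
    exact x.2
  have ha := hQcomp.sInf_mem hQconn.nonempty
  have hb := hQcomp.sSup_mem hQconn.nonempty
  refine ⟨sInf Q, sSup Q, (hsub ha).1, ?_, (hsub hb).2, ?_⟩
  · exact (hQIcc.le ha).2
  · rw [← hQIcc, hQP]

/-- The tuples of `n` nonempty compact subintervals of `[s, L]`, listed from left to right, with
gaps of length at least `s`; a tuple is recorded through the endpoints of its intervals. -/
def sepIntervals (s L : ℝ) (n : ℕ) : Set (Fin n → ℝ × ℝ) :=
  {c | (∀ j, s ≤ (c j).1 ∧ (c j).1 ≤ (c j).2 ∧ (c j).2 ≤ L) ∧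
    ∀ j k, j < k → (c j).2 + s ≤ (c k).1}

theorem isCompact_sepIntervals (s L : ℝ) (n : ℕ) : IsCompact (sepIntervals s L n) := by
  refine (isCompact_univ_pi fun _ : Fin n =>
    (isCompact_Icc (a := s) (b := L)).prod (isCompact_Icc (a := s) (b := L))).of_isClosed_subset
      ?_ ?_
  · simp only [sepIntervals, Set.ofPred_and, Set.ofPred_forall]
    refine IsClosed.inter (isClosed_iInter fun j => ?_)
      (isClosed_iInter fun j => isClosed_iInter fun k => isClosed_iInter fun _ => ?_)
    · exact (isClosed_le (by fun_prop) (by fun_prop)).inter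
        ((isClosed_le (by fun_prop) (by fun_prop)).inter
          (isClosed_le (by fun_prop) (by fun_prop)))
    · exact isClosed_le (by fun_prop) (by fun_prop)
  · rintro c ⟨hc, -⟩ j -
    obtain ⟨h₁, h₂, h₃⟩ := hc j
    exact ⟨⟨h₁, h₂.trans h₃⟩, ⟨h₁.trans h₂, h₃⟩⟩

/-- Among `n + 1` nonempty `s`-separated pieces of the circle, all but one lie in the arc
`[s, L]`, where they can be listed from left to right. -/
theorem IsSepFamily.exists_sepIntervals {s L : ℝ} [Fact (0 < L)] (hs : 0 < s) {n : ℕ}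
    {P : Fin (n + 1) → Set (AddCircle L)} (hP : ∀ j, IsCirclePiece (P j))
    (hne : ∀ j, (P j).Nonempty) (hsep : IsSepFamily s P) :
    ∃ c ∈ sepIntervals s L n, ∀ j, ∃ k,
      P k = (fun x : ℝ => (x : AddCircle L)) '' Set.Icc (c j).1 (c j).2 := by
  obtain ⟨k₀, hk₀⟩ : ∃ k₀, ∀ k, k ≠ k₀ → ∀ x ∈ Set.Ioo 0 s, (x : AddCircle L) ∉ P k := by
    by_cases h : ∃ k₀, ∃ x ∈ Set.Ioo 0 s, (x : AddCircle L) ∈ P k₀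
    · obtain ⟨k₀, x, hx, hxP⟩ := h
      refine ⟨k₀, fun k hk y hy hyP => ?_⟩
      have h₁ := (hsep k k₀ hk _ hyP _ hxP).trans (dist_coe_addCircle_le y x)
      have h₂ : |y - x| < s := by
        rw [abs_lt]
        constructor <;> linarith [hx.1, hx.2, hy.1, hy.2]
      exact h₂.not_ge h₁
    · push Not at h
      exact ⟨0, fun k _ => h k⟩
  have harc (j : Fin n) := exists_eq_coe_image_Icc hs
    ((hP (k₀.succAbove j)).resolve_left (hne _).ne_empty).1
    ((hP (k₀.succAbove j)).resolve_left (hne _).ne_empty).2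
    (hk₀ _ (Fin.succAbove_ne k₀ j))
  choose a b hsa hab hbL hPab using harc
  have hdist : ∀ j k, j ≠ k → ∀ x ∈ Set.Icc (a j) (b j), ∀ y ∈ Set.Icc (a k) (b k),
      s ≤ |x - y| := by
    intro j k hjk x hx y hy
    refine (hsep (k₀.succAbove j) (k₀.succAbove k)
      (fun h => hjk (Fin.succAbove_right_injective h)) x ?_ y ?_).trans
      (dist_coe_addCircle_le x y)
    · rw [hPab]
      exact Set.mem_image_of_mem _ hx
    · rw [hPab]
      exact Set.mem_image_of_mem _ hy
  refine ⟨fun j => (a (Tuple.sort a j), b (Tuple.sort a j)),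
    ⟨fun j => ⟨hsa _, hab _, hbL _⟩, fun j k hjk => ?_⟩, fun j => ⟨_, hPab _⟩⟩
  change b (Tuple.sort a j) + s ≤ a (Tuple.sort a k)
  have hle : a (Tuple.sort a j) ≤ a (Tuple.sort a k) := Tuple.monotone_sort a hjk.le
  have hne' : Tuple.sort a j ≠ Tuple.sort a k := fun h => hjk.ne ((Tuple.sort a).injective h)
  generalize Tuple.sort a j = p at *
  generalize Tuple.sort a k = q at *
  have hlt : b p < a q := by
    by_contra! h
    have := hdist p q hne' (a q) ⟨hle, h⟩ (a q) ⟨le_rfl, hab q⟩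
    rw [sub_self, abs_zero] at this
    exact this.not_gt hs
  have := hdist p q hne' (b p) ⟨hab p, le_rfl⟩ (a q) ⟨le_rfl, hab q⟩
  rw [abs_of_neg (by linarith)] at this
  linarith

/-- On the arc `[s, L]`, the measure of a subarc is a continuous function of its endpoints. -/
theorem exists_continuous_measure_coe_image_Icc {s L : ℝ} [Fact (0 < L)] (hs : 0 < s)
    [MeasurableSpace (AddCircle L)] [BorelSpace (AddCircle L)]
    (μ : Measure (AddCircle L)) [IsFiniteMeasure μ] (hna : ∀ x, μ {x} = 0) :
    ∃ F : ℝ × ℝ → ℝ, Continuous F ∧ ∀ a b, s ≤ a → a ≤ b → b ≤ L →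
      F (a, b) = (μ ((fun x : ℝ => (x : AddCircle L)) '' Set.Icc a b)).toReal := by
  have hf := (isClosedEmbedding_coe_Icc_addCircle (L := L) hs).measurableEmbedding
  set f := fun x : Set.Icc s L => ((x : ℝ) : AddCircle L)
  set ν : Measure ℝ := (μ.comap f).map Subtype.val with hν
  have hνapply : ∀ E, MeasurableSet E → ν E = μ (f '' (Subtype.val ⁻¹' E)) := fun E hE => by
    rw [hν, Measure.map_apply measurable_subtype_coe hE, hf.comap_apply]
  have hfin : IsFiniteMeasure ν := ⟨by
    rw [hνapply _ MeasurableSet.univ]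
    exact measure_lt_top _ _⟩
  have hatom : NullSingletonClass ν := ⟨fun x => by
    rw [hνapply _ (measurableSet_singleton x)]
    have hsub : (f '' (Subtype.val ⁻¹' {x})).Subsingleton :=
      (Set.subsingleton_singleton.preimage Subtype.val_injective).image f
    rcases hsub.eq_empty_or_singleton with h | ⟨y, h⟩
    · rw [h, measure_empty]
    · rw [h, hna]⟩
  have hint : ∀ a b, IntervalIntegrable (fun _ : ℝ => (1 : ℝ)) ν a b := fun a b =>
    intervalIntegrable_const
  have hcont := intervalIntegral.continuous_primitive hint s
  refine ⟨fun p => (∫ _ in s..p.2, (1 : ℝ) ∂ν) - ∫ _ in s..p.1, (1 : ℝ) ∂ν,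
    (hcont.comp continuous_snd).sub (hcont.comp continuous_fst), fun a b ha hab hb => ?_⟩
  have himage : f '' (Subtype.val ⁻¹' Set.Icc a b) =
      (fun x : ℝ => (x : AddCircle L)) '' Set.Icc a b := by
    ext p
    constructor
    · rintro ⟨x, hx, rfl⟩
      exact ⟨x, hx, rfl⟩
    · rintro ⟨x, hx, rfl⟩
      exact ⟨⟨x, ha.trans hx.1, hx.2.trans hb⟩, hx, rfl⟩
  dsimp only
  rw [intervalIntegral.integral_interval_sub_left (hint _ _) (hint _ _),
    intervalIntegral.integral_of_le hab, ← himage, ← hνapply _ measurableSet_Icc,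
    ← Ioc_ae_eq_Icc.measure_eq]
  simp [measureReal_def]

/-- A positive maximin share on the circle with `n + 1` pieces is attained by `n` separated
intervals of the arc `[s, L]`. -/
theorem exists_sepIntervals_forall_sSup_le {s L : ℝ} [Fact (0 < L)] (hs : 0 < s)
    [MeasurableSpace (AddCircle L)] [BorelSpace (AddCircle L)] {n : ℕ} (hn : 1 ≤ n)
    (μ : Measure (AddCircle L)) [IsFiniteMeasure μ] (hna : ∀ x, μ {x} = 0) {S : Set ℝ}
    (hS : S = {t : ℝ | ∃ P : Fin (n + 1) → Set (AddCircle L),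
      (∀ j, IsCirclePiece (P j)) ∧ IsSepFamily s P ∧
      t = ⨅ j : Fin (n + 1), (μ (P j)).toReal}) (hpos : 0 < sSup S) :
    ∃ c ∈ sepIntervals s L n, ∀ j, sSup S ≤
      (μ ((fun x : ℝ => (x : AddCircle L)) '' Set.Icc (c j).1 (c j).2)).toReal := by
  obtain ⟨F, hF, hFμ⟩ := exists_continuous_measure_coe_image_Icc (L := L) hs μ hna
  have hFc : ∀ c ∈ sepIntervals s L n, ∀ j, F (c j) =
      (μ ((fun x : ℝ => (x : AddCircle L)) '' Set.Icc (c j).1 (c j).2)).toReal :=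
    fun c hc j => hFμ _ _ (hc.1 j).1 (hc.1 j).2.1 (hc.1 j).2.2
  have hSne : S.Nonempty := by
    by_contra! h
    simp [h] at hpos
  have happrox : ∀ t < sSup S, ∃ c ∈ sepIntervals s L n, ∀ j, t ≤ F (c j) := by
    intro t ht
    obtain ⟨r, hr, htr⟩ := exists_lt_of_lt_csSup hSne (max_lt ht hpos)
    rw [hS] at hr
    obtain ⟨P, hP, hsep, rfl⟩ := hr
    obtain ⟨htr, h0r⟩ := max_lt_iff.1 htr
    have hle : ∀ k, (⨅ j, (μ (P j)).toReal) ≤ (μ (P k)).toReal :=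
      ciInf_le (Set.finite_range _).bddBelow
    have hne : ∀ k, (P k).Nonempty := by
      intro k
      by_contra! h
      have := hle k
      rw [h, measure_empty, ENNReal.toReal_zero] at this
      linarith
    obtain ⟨c, hc, hcP⟩ := hsep.exists_sepIntervals hs hP hne
    refine ⟨c, hc, fun j => ?_⟩
    obtain ⟨k, hk⟩ := hcP j
    rw [hFc c hc, ← hk]
    exact htr.le.trans (hle k)
  have : Nonempty (Fin n) := ⟨⟨0, hn⟩⟩
  obtain ⟨c₀, hc₀, -⟩ := happrox 0 hpos
  obtain ⟨c, hc, hmax⟩ := (isCompact_sepIntervals s L n).exists_isMaxOn ⟨c₀, hc₀⟩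
    (f := fun c => Finset.univ.inf' Finset.univ_nonempty fun j => F (c j))
    (Continuous.finset_inf'_apply _ fun j _ => hF.comp (continuous_apply j)).continuousOn
  refine ⟨c, hc, fun j => ?_⟩
  rw [← hFc c hc]
  refine le_of_forall_lt_imp_le_of_dense fun t ht => ?_
  obtain ⟨d, hd, htd⟩ := happrox t ht
  calc t ≤ Finset.univ.inf' Finset.univ_nonempty fun j => F (d j) :=
        Finset.le_inf' _ _ fun k _ => htd k
    _ ≤ Finset.univ.inf' Finset.univ_nonempty fun j => F (c j) := hmax hd
    _ ≤ F (c j) := Finset.inf'_le _ (Finset.mem_univ j)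

/-- The last diminisher procedure: if every agent lists `s`-separated intervals from left to
right, each agent can be given one of her own intervals so that the chosen ones are
`s`-separated. -/
theorem exists_separated_choice {ι : Type*} [DecidableEq ι] {s : ℝ} {n : ℕ}
    (c : ι → Fin n → ℝ × ℝ) (S : Finset ι)
    (hsep : ∀ i ∈ S, ∀ j k, j < k → (c i j).2 + s ≤ (c i k).1) (m : ℕ) (hm : m + S.card ≤ n) :
    ∃ σ : ι → ℕ, ∃ hσ : ∀ i ∈ S, σ i < n, (∀ i ∈ S, m ≤ σ i) ∧
      ∀ i (hi : i ∈ S) j (hj : j ∈ S), i ≠ j →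
        (c i ⟨σ i, hσ i hi⟩).2 + s ≤ (c j ⟨σ j, hσ j hj⟩).1 ∨
        (c j ⟨σ j, hσ j hj⟩).2 + s ≤ (c i ⟨σ i, hσ i hi⟩).1 := by
  induction hk : S.card generalizing S m with
  | zero =>
    obtain rfl := Finset.card_eq_zero.1 hk
    exact ⟨fun _ => 0, by simp, by simp, by simp⟩
  | succ k ih =>
    have hmn : m < n := by omega
    obtain ⟨i₀, hi₀, hmin⟩ := S.exists_min_image (fun i => (c i ⟨m, hmn⟩).2)
      (Finset.card_pos.1 (by omega))
    have hcard := Finset.card_erase_of_mem hi₀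
    obtain ⟨σ, hσ, hmσ, hσsep⟩ := ih (S.erase i₀)
      (fun i hi => hsep i (Finset.mem_of_mem_erase hi)) (m + 1) (by omega) (by omega)
    have hfirst : ∀ j (hj : j ∈ S.erase i₀),
        (c i₀ ⟨m, hmn⟩).2 + s ≤ (c j ⟨σ j, hσ j hj⟩).1 := fun j hj =>
      (add_le_add_left (hmin j (Finset.mem_of_mem_erase hj)) s).trans
        (hsep j (Finset.mem_of_mem_erase hj) _ _ (Fin.mk_lt_mk.2 (hmσ j hj)))
    have hτ : ∀ i ∈ S, Function.update σ i₀ m i < n := by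
      intro i hi
      by_cases h : i = i₀
      · simpa [h] using hmn
      · simpa [h] using hσ i (Finset.mem_erase.2 ⟨h, hi⟩)
    refine ⟨Function.update σ i₀ m, hτ, fun i hi => ?_, fun i hi j hj hij => ?_⟩
    · by_cases h : i = i₀
      · simp [h]
      · simpa [h] using (Nat.le_succ m).trans (hmσ i (Finset.mem_erase.2 ⟨h, hi⟩))
    · by_cases hi' : i = i₀
      · subst hi'
        left
        simpa [hij.symm] using hfirst j (Finset.mem_erase.2 ⟨hij.symm, hj⟩)
      · by_cases hj' : j = i₀
        · subst hj'
          right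
          simpa [hij] using hfirst i (Finset.mem_erase.2 ⟨hij, hi⟩)
        · simpa [hi', hj'] using hσsep i (Finset.mem_erase.2 ⟨hi', hi⟩) j
            (Finset.mem_erase.2 ⟨hj', hj⟩) hij


/-- STATEMENT 11: For `0 < s < L` and `n ≥ 1` agents with finite nonatomic Borel measures
on the circle `ℝ/Lℤ`, there is an `s`-separated family of `n` pieces giving every agent `i`
at least her 1-out-of-(n+1) maximin share `MMS_i^{n+1} = sup` over `s`-separated families
of `n+1` pieces of `min_j μ_i(P_j)`. -/
theorem one_out_of_succ_maximin_allocation_exists_circle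
    (s L : ℝ) (hs : 0 < s) (hL : s < L) [Fact (0 < L)]
    [MeasurableSpace (AddCircle L)] [BorelSpace (AddCircle L)]
    (n : ℕ) (hn : 1 ≤ n)
    (μ : Fin n → Measure (AddCircle L)) (hfin : ∀ i, IsFiniteMeasure (μ i))
    (hna : ∀ i (x : AddCircle L), μ i {x} = 0) :
    ∃ A : Fin n → Set (AddCircle L),
      (∀ i, IsCirclePiece (A i)) ∧ IsSepFamily s A ∧
      ∀ i : Fin n,
        sSup {t : ℝ | ∃ P : Fin (n + 1) → Set (AddCircle L),
            (∀ j, IsCirclePiece (P j)) ∧ IsSepFamily s P ∧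
            t = ⨅ j : Fin (n + 1), (μ i (P j)).toReal}
          ≤ (μ i (A i)).toReal := by
  classical
  set M : Fin n → ℝ := fun i => sSup {t : ℝ | ∃ P : Fin (n + 1) → Set (AddCircle L),
    (∀ j, IsCirclePiece (P j)) ∧ IsSepFamily s P ∧
    t = ⨅ j : Fin (n + 1), (μ i (P j)).toReal} with hM
  have hatt : ∀ i, ∃ c : Fin n → ℝ × ℝ, 0 < M i → c ∈ sepIntervals s L n ∧ ∀ j, M i ≤
      (μ i ((fun x : ℝ => (x : AddCircle L)) '' Set.Icc (c j).1 (c j).2)).toReal := by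
    intro i
    by_cases hpos : 0 < M i
    · have := hfin i
      obtain ⟨c, hc⟩ := exists_sepIntervals_forall_sSup_le hs hn (μ i) (hna i) rfl hpos
      exact ⟨c, fun _ => hc⟩
    · exact ⟨0, fun h => absurd h hpos⟩
  choose c hc using hatt
  set S : Finset (Fin n) := {i | 0 < M i} with hS
  have hSmem : ∀ i, i ∈ S ↔ 0 < M i := by simp [hS]
  obtain ⟨σ, hσ, -, hsep⟩ := exists_separated_choice c S
    (fun i hi => (hc i ((hSmem i).1 hi)).1.2) 0 (by simpa using S.card_le_univ)
  refine ⟨fun i => if hi : i ∈ S then (fun x : ℝ => (x : AddCircle L)) ''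
    Set.Icc (c i ⟨σ i, hσ i hi⟩).1 (c i ⟨σ i, hσ i hi⟩).2 else ∅, fun i => ?_,
    fun i j hij x hx y hy => ?_, fun i => ?_⟩
  · by_cases hi : i ∈ S
    · have hle := ((hc i ((hSmem i).1 hi)).1.1 ⟨σ i, hσ i hi⟩).2.1
      simp only [hi, dite_true]
      have hcont : Continuous fun x : ℝ => (x : AddCircle L) := AddCircle.continuous_mk' L
      exact Or.inr ⟨(isCompact_Icc.image hcont).isClosed,
        (isConnected_Icc hle).image _ hcont.continuousOn⟩
    · simp only [hi, dite_false]
      exact Or.inl rfl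
  · by_cases hi : i ∈ S
    · by_cases hj : j ∈ S
      · simp only [hi, hj, dite_true] at hx hy
        obtain ⟨x, hx, rfl⟩ := hx
        obtain ⟨y, hy, rfl⟩ := hy
        have hbi := (hc i ((hSmem i).1 hi)).1.1 ⟨σ i, hσ i hi⟩
        have hbj := (hc j ((hSmem j).1 hj)).1.1 ⟨σ j, hσ j hj⟩
        rcases hsep i hi j hj hij with h | h
        · exact le_dist_coe_addCircle hs (by linarith [hx.1]) (by linarith [hx.2, hy.1])
            (by linarith [hy.2])
        · rw [dist_comm]
          exact le_dist_coe_addCircle hs (by linarith [hy.1]) (by linarith [hy.2, hx.1])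
            (by linarith [hx.2])
      · simp [hj] at hy
    · simp [hi] at hx
  · change M i ≤ _
    by_cases hi : i ∈ S
    · simp only [hi, dite_true]
      exact (hc i ((hSmem i).1 hi)).2 _
    · exact (not_lt.1 fun h => hi ((hSmem i).2 h)).trans ENNReal.toReal_nonneg
end

section
/- For every real number s > 0 and every integer n ≥ 2, there exist a real number L > 0 and finite nonatomic Borel measures μ_1, …, μ_n on the circle AddCircle L with the following properties: (i) for every agent i, MMS_i^{n} = 1, where MMS_i^{n} := sup over all s-separated families (P_1,…,P_n) of pieces (subsets of AddCircle L that are empty or closed and connected) of min_{1≤j≤n} μ_i(P_j); and (ii) for every s-separated family (A_1,…,A_n) of pieces, there exists some agent i with μ_i(A_i) = 0. In particular, no s-separated allocation gives every agent i a piece of value at least MMS_i^{n}. -/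
open MeasureTheory

/-- The `k`-th slot with offset `a`: an interval of length `u`; consecutive slots are `6 * u`
apart. -/
def slot (u a : ℝ) (k : ℕ) : Set ℝ := Set.Icc (a + 6 * u * k) (a + 6 * u * k + u)

/-- The measure on the circle giving mass `1`, spread uniformly, to each of the first `n` slots
with offset `a`. -/
noncomputable def slotMeasure (L u a : ℝ) (n : ℕ) [MeasurableSpace (AddCircle L)] :
    Measure (AddCircle L) :=
  ENNReal.ofReal u⁻¹ • ∑ k : Fin n,
    (volume.restrict (slot u a k)).map (fun t : ℝ => (t : AddCircle L))

theorem AddCircle.le_dist_coe {L x y d : ℝ} (h : ∀ z : ℤ, d ≤ |x - y - z * L|) :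
    d ≤ dist (x : AddCircle L) (y : AddCircle L) := by
  rw [dist_eq_norm, ← AddCircle.coe_sub, AddCircle.norm_eq]
  exact h _

theorem AddCircle.dist_coe_le (L x y : ℝ) (z : ℤ) :
    dist (x : AddCircle L) (y : AddCircle L) ≤ |x - y - z * L| := by
  have h : ((x - y - z * L : ℝ) : AddCircle L) = (x : AddCircle L) - (y : AddCircle L) := by
    rw [AddCircle.coe_sub, AddCircle.coe_sub, ← zsmul_eq_mul, AddCircle.coe_zsmul,
      AddCircle.coe_period, smul_zero, sub_zero]
  rw [dist_eq_norm, ← h, ← Real.norm_eq_abs]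
  exact QuotientAddGroup.norm_mk_le_norm

theorem le_dist_of_mem_slot {u a x y : ℝ} (hu : 0 < u) {n : ℕ} {j k : Fin n} (hjk : j ≠ k)
    (hx : x ∈ slot u a j) (hy : y ∈ slot u a k) :
    5 * u ≤ dist (x : AddCircle (6 * u * n)) (y : AddCircle (6 * u * n)) := by
  refine AddCircle.le_dist_coe fun z => ?_
  obtain ⟨hx1, hx2⟩ := hx
  obtain ⟨hy1, hy2⟩ := hy
  have hne : (j : ℤ) - k - z * n ≠ 0 := by
    intro h
    have hj : ((j : ℕ) : ℤ) < n := by exact_mod_cast j.isLt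
    have hk : ((k : ℕ) : ℤ) < n := by exact_mod_cast k.isLt
    have hz : |z * n| < (n : ℤ) := by rw [abs_lt]; constructor <;> linarith
    rw [abs_mul, Nat.abs_cast] at hz
    have hz0 : |z| < 1 := by
      by_contra! hc
      nlinarith
    have hz1 : z = 0 := Int.abs_lt_one_iff.mp hz0
    subst hz1
    exact hjk (Fin.ext (by lia))
  rcases lt_or_gt_of_ne hne with h | h
  · have h' : (j : ℤ) - k - z * n ≤ -1 := by lia
    have h'' : (j : ℝ) - k - z * n ≤ -1 := by exact_mod_cast h'
    rw [le_abs]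
    right
    nlinarith
  · have h' : 1 ≤ (j : ℤ) - k - z * n := by lia
    have h'' : 1 ≤ (j : ℝ) - k - z * n := by exact_mod_cast h'
    rw [le_abs]
    left
    nlinarith

theorem isCirclePiece_image_slot {L u a : ℝ} [Fact (0 < L)] (hu : 0 < u) (k : ℕ) :
    IsCirclePiece ((fun t : ℝ => (t : AddCircle L)) '' slot u a k) := by
  have hc := AddCircle.continuous_mk' L
  exact .inr ⟨(isCompact_Icc.image hc).isClosed,
    (isConnected_Icc (by linarith)).image _ hc.continuousOn⟩

section SlotMeasure

variable {L u a : ℝ} {n : ℕ} [MeasurableSpace (AddCircle L)] [BorelSpace (AddCircle L)]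

theorem measurable_coe_addCircle : Measurable (fun t : ℝ => (t : AddCircle L)) :=
  (AddCircle.continuous_mk' L).measurable

theorem slotMeasure_apply {A : Set (AddCircle L)} (hA : MeasurableSet A) :
    slotMeasure L u a n A = ENNReal.ofReal u⁻¹ * ∑ k : Fin n,
      volume ((fun t : ℝ => (t : AddCircle L)) ⁻¹' A ∩ slot u a k) := by
  simp only [slotMeasure, Measure.smul_apply, Measure.coe_finsetSum, Finset.sum_apply, smul_eq_mul]
  congr 1
  refine Finset.sum_congr rfl fun k _ => ?_
  rw [Measure.map_apply measurable_coe_addCircle hA,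
    Measure.restrict_apply (measurable_coe_addCircle hA)]

theorem volume_slot (k : ℕ) : volume (slot u a k) = ENNReal.ofReal u := by
  rw [slot, Real.volume_Icc, add_sub_cancel_left]

theorem ofReal_inv_mul_ofReal_self (hu : 0 < u) :
    ENNReal.ofReal u⁻¹ * ENNReal.ofReal u = 1 := by
  rw [← ENNReal.ofReal_mul (inv_nonneg.mpr hu.le), inv_mul_cancel₀ hu.ne', ENNReal.ofReal_one]

theorem slotMeasure_univ (hu : 0 < u) : slotMeasure L u a n Set.univ = n := by
  rw [slotMeasure_apply MeasurableSet.univ]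
  simp only [Set.preimage_univ, Set.univ_inter, volume_slot, Finset.sum_const, Finset.card_univ,
    Fintype.card_fin, nsmul_eq_mul]
  rw [mul_left_comm, ofReal_inv_mul_ofReal_self hu, mul_one]

theorem slotMeasure_singleton [Fact (0 < L)] (x : AddCircle L) :
    slotMeasure L u a n {x} = 0 := by
  have hc : ((fun t : ℝ => (t : AddCircle L)) ⁻¹' {x}).Countable := by
    induction x using QuotientAddGroup.induction_on with
    | H b =>
      refine (Set.countable_range fun m : ℤ => b + m • L).mono fun t ht => ?_
      have h : ((t - b : ℝ) : AddCircle L) = 0 := by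
        rw [AddCircle.coe_sub, sub_eq_zero]
        exact ht
      obtain ⟨m, hm⟩ := AddCircle.coe_eq_zero_iff L |>.mp h
      exact ⟨m, by simp only [hm]; ring⟩
  rw [slotMeasure_apply (measurableSet_singleton x)]
  simp [measure_mono_null Set.inter_subset_left (hc.measure_zero volume)]

theorem exists_mem_slot_of_slotMeasure_ne_zero {A : Set (AddCircle L)} (hA : MeasurableSet A)
    (h : slotMeasure L u a n A ≠ 0) :
    ∃ k : Fin n, ∃ t ∈ slot u a k, (t : AddCircle L) ∈ A := by
  rw [slotMeasure_apply hA] at h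
  obtain ⟨k, -, hk⟩ := Finset.exists_ne_zero_of_sum_ne_zero (right_ne_zero_of_mul h)
  obtain ⟨t, ht, ht'⟩ := nonempty_of_measure_ne_zero hk
  exact ⟨k, t, ht', ht⟩

theorem one_le_slotMeasure_image_slot (hu : 0 < u) (j : Fin n)
    (hm : MeasurableSet ((fun t : ℝ => (t : AddCircle L)) '' slot u a j)) :
    1 ≤ slotMeasure L u a n ((fun t : ℝ => (t : AddCircle L)) '' slot u a j) := by
  rw [slotMeasure_apply hm, ← ofReal_inv_mul_ofReal_self hu]
  gcongr
  refine le_trans ?_ (Finset.single_le_sum (fun _ _ => zero_le) (Finset.mem_univ j))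
  rw [← volume_slot (a := a) (j : ℕ)]
  exact measure_mono (Set.subset_inter (Set.subset_preimage_image _ _) subset_rfl)

theorem IsCirclePiece.measurableSet {P : Set (AddCircle L)} (hP : IsCirclePiece P) :
    MeasurableSet P := by
  rcases hP with rfl | ⟨h, -⟩
  · exact MeasurableSet.empty
  · exact h.measurableSet

end SlotMeasure

theorem IsSepFamily.pairwise_disjoint {L s : ℝ} [Fact (0 < L)] (hs : 0 < s) {m : ℕ}
    {P : Fin m → Set (AddCircle L)} (hP : IsSepFamily s P) : Pairwise (Function.onFun Disjoint P) := by
  intro i j hij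
  refine Set.disjoint_left.mpr fun x hi hj => ?_
  have := hP i j hij x hi x hj
  rw [dist_self] at this
  linarith

/-- A measure of total mass `n` has no family of `n` disjoint measurable sets of measure
greater than `1` each. -/
theorem iInf_toReal_le_one {X : Type*} [MeasurableSpace X] {n : ℕ} (hn : 0 < n) (μ : Measure X)
    (hμ : μ Set.univ = n) {P : Fin n → Set X} (hd : Pairwise (Function.onFun Disjoint P))
    (hP : ∀ j, MeasurableSet (P j)) : ⨅ j, (μ (P j)).toReal ≤ 1 := by
  have : IsFiniteMeasure μ := ⟨by simp [hμ]⟩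
  by_contra! hc
  have hb : BddBelow (Set.range fun j => (μ (P j)).toReal) :=
    ⟨0, by rintro _ ⟨j, rfl⟩; exact ENNReal.toReal_nonneg⟩
  have h1 : ∑ j, μ.real (P j) ≤ n := by
    rw [← measureReal_iUnion_fintype hd hP]
    refine (measureReal_mono (Set.subset_univ _)).trans ?_
    simp [Measure.real, hμ]
  have h2 : ∑ _j : Fin n, (1 : ℝ) < ∑ j, μ.real (P j) :=
    Finset.sum_lt_sum_of_nonempty ⟨⟨0, hn⟩, Finset.mem_univ _⟩
      fun j _ => hc.trans_le (ciInf_le hb j)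
  simp at h2
  linarith

theorem sSup_slotMeasure_eq_one {u a : ℝ} {n : ℕ} (hu : 0 < u) (hn : 0 < n)
    [Fact (0 < 6 * u * n)] [MeasurableSpace (AddCircle (6 * u * n))]
    [BorelSpace (AddCircle (6 * u * n))] :
    sSup {t : ℝ | ∃ P : Fin n → Set (AddCircle (6 * u * n)),
      (∀ j, IsCirclePiece (P j)) ∧ IsSepFamily (5 * u) P ∧
      t = ⨅ j : Fin n, (slotMeasure (6 * u * n) u a n (P j)).toReal} = 1 := by
  have key : ∀ P : Fin n → Set (AddCircle (6 * u * n)), (∀ j, IsCirclePiece (P j)) →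
      IsSepFamily (5 * u) P → ⨅ j, (slotMeasure (6 * u * n) u a n (P j)).toReal ≤ 1 :=
    fun P hP hsep => iInf_toReal_le_one hn _ (slotMeasure_univ hu)
      (hsep.pairwise_disjoint (by positivity)) fun j => (hP j).measurableSet
  refine IsGreatest.csSup_eq ⟨?_, ?_⟩
  · have hP := fun j : Fin n => isCirclePiece_image_slot (L := 6 * u * n) (a := a) hu (j : ℕ)
    have hsep : IsSepFamily (5 * u)
        (fun j : Fin n => (fun t : ℝ => (t : AddCircle (6 * u * n))) '' slot u a j) := by
      rintro i j hij _ ⟨x, hx, rfl⟩ _ ⟨y, hy, rfl⟩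
      exact le_dist_of_mem_slot hu hij hx hy
    refine ⟨_, hP, hsep, le_antisymm ?_ (key _ hP hsep)⟩
    have : Nonempty (Fin n) := ⟨⟨0, hn⟩⟩
    refine le_ciInf fun j => ?_
    rw [← ENNReal.toReal_one]
    refine ENNReal.toReal_mono ?_ (one_le_slotMeasure_image_slot hu j (hP j).measurableSet)
    refine ne_top_of_le_ne_top ?_ (measure_mono (Set.subset_univ _))
    rw [slotMeasure_univ hu]
    exact ENNReal.natCast_ne_top n
  · rintro _ ⟨P, hP, hsep, rfl⟩
    exact key P hP hsep

/-- If the points `t i` lie in slots with offset `0`, except for one with offset `3 * u`, then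
two of them are at distance less than `5 * u` on the circle. -/
theorem exists_dist_lt_of_mem_slot {u : ℝ} (hu : 0 < u) {n : ℕ} (hn : 2 ≤ n) (l : Fin n)
    (k : Fin n → Fin n) (t : Fin n → ℝ)
    (ht : ∀ i, t i ∈ slot u (if i = l then 3 * u else 0) (k i)) :
    ∃ i j, i ≠ j ∧ dist (t i : AddCircle (6 * u * n)) (t j : AddCircle (6 * u * n)) < 5 * u := by
  by_contra! hsep
  have hinj : Function.Injective k := by
    intro i j hij
    by_contra hne
    have h := (hsep i j hne).trans (AddCircle.dist_coe_le _ _ _ 0)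
    obtain ⟨hi1, hi2⟩ := ht i
    obtain ⟨hj1, hj2⟩ := ht j
    rw [hij] at hi1 hi2
    rw [le_abs] at h
    push_cast at h
    split_ifs at hi1 hi2 hj1 hj2 <;> rcases h with h | h <;> linarith
  have hsurj : Function.Surjective k := Finite.surjective_of_injective hinj
  obtain ⟨hl1, hl2⟩ := ht l
  simp only [if_true] at hl1 hl2
  by_cases hk : (k l : ℕ) + 1 < n
  · obtain ⟨i, hi⟩ := hsurj ⟨k l + 1, hk⟩
    have hil : i ≠ l := by
      rintro rfl
      have := congrArg Fin.val hi
      simp at this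
    have h := (hsep i l hil).trans (AddCircle.dist_coe_le _ _ _ 0)
    obtain ⟨hi1, hi2⟩ := ht i
    rw [hi, if_neg hil] at hi1 hi2
    rw [le_abs] at h
    push_cast at h hi1 hi2
    rcases h with h | h <;> linarith
  · obtain ⟨i, hi⟩ := hsurj ⟨0, by lia⟩
    have hkn : (k l : ℕ) + 1 = n := by have := (k l).isLt; lia
    have hil : i ≠ l := by
      rintro rfl
      have := congrArg Fin.val hi
      simp at this
      lia
    have h := (hsep i l hil).trans (AddCircle.dist_coe_le _ _ _ (-1))
    obtain ⟨hi1, hi2⟩ := ht i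
    rw [hi, if_neg hil] at hi1 hi2
    have hkn' : (n : ℝ) = (k l : ℕ) + 1 := by exact_mod_cast hkn.symm
    rw [le_abs, hkn'] at h
    push_cast at h hi1 hi2
    rcases h with h | h <;> linarith

/-- STATEMENT 12: For every `s > 0` and `n ≥ 2` there is a circle `ℝ/Lℤ` (for some `L > 0`)
and finite nonatomic Borel measures `μ_1,…,μ_n` on it such that every agent's 1-out-of-n
maximin share (with `s`-separation) equals 1, yet in every `s`-separated family
`(A_1,…,A_n)` of pieces some agent receives a piece of measure 0. In particular no
`s`-separated maximin allocation exists. -/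
theorem maximin_allocation_nonexistence_circle (s : ℝ) (hs : 0 < s) (n : ℕ) (hn : 2 ≤ n) :
    ∃ (L : ℝ) (hL : 0 < L),
      letI : Fact (0 < L) := ⟨hL⟩
      letI : MeasurableSpace (AddCircle L) := borel _
      ∃ μ : Fin n → Measure (AddCircle L),
        (∀ i, IsFiniteMeasure (μ i)) ∧
        (∀ i (x : AddCircle L), μ i {x} = 0) ∧
        (∀ i : Fin n,
          sSup {t : ℝ | ∃ P : Fin n → Set (AddCircle L),
              (∀ j, IsCirclePiece (P j)) ∧ IsSepFamily s P ∧
              t = ⨅ j : Fin n, (μ i (P j)).toReal} = 1) ∧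
        (∀ A : Fin n → Set (AddCircle L),
          (∀ i, IsCirclePiece (A i)) → IsSepFamily s A →
          ∃ i : Fin n, μ i (A i) = 0) := by
  obtain ⟨u, rfl⟩ : ∃ u, s = 5 * u := ⟨s / 5, by ring⟩
  have hu : 0 < u := by linarith
  have hn0 : 0 < n := by lia
  have hL : 0 < 6 * u * n := by positivity
  refine ⟨6 * u * n, hL, ?_⟩
  let : Fact (0 < 6 * u * n) := ⟨hL⟩
  let : MeasurableSpace (AddCircle (6 * u * n)) := borel _
  have : BorelSpace (AddCircle (6 * u * n)) := ⟨rfl⟩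
  let l : Fin n := ⟨0, hn0⟩
  refine ⟨fun i => slotMeasure (6 * u * n) u (if i = l then 3 * u else 0) n, fun i => ⟨?_⟩,
    fun i x => slotMeasure_singleton x, fun i => sSup_slotMeasure_eq_one hu hn0, ?_⟩
  · rw [slotMeasure_univ hu]
    exact ENNReal.natCast_lt_top n
  · intro A hA hsep
    by_contra! hne
    choose k t ht htA using fun i =>
      exists_mem_slot_of_slotMeasure_ne_zero (hA i).measurableSet (hne i)
    obtain ⟨i, j, hij, hlt⟩ := exists_dist_lt_of_mem_slot hu hn l k t ht
    exact hlt.not_ge (hsep i j hij _ (htA i) _ (htA j))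
end

section
/- Let n ≥ 1 and let μ_1, …, μ_n be finite Borel measures on ℝ that are nonatomic (μ_i({x}) = 0 for every point x). A piece is a subset of [0,1] that is order-connected (an interval, possibly empty, open, half-open, or closed). For each agent i define MMS_i := sup over all families (P_1,…,P_n) of pairwise disjoint pieces of min_{1≤j≤n} μ_i(P_j). Then there exists a family (A_1,…,A_n) of pairwise disjoint pieces such that μ_i(A_i) ≥ MMS_i for every i ∈ {1,…,n}. -/
open MeasureTheory

/-- A piece of the interval cake `[0,1]`: an order-connected subset of `[0,1]`
(an interval, possibly empty, open, half-open, or closed). -/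
def IsIntervalPiece (P : Set ℝ) : Prop :=
  P ⊆ Set.Icc (0:ℝ) 1 ∧ P.OrdConnected

/-- The mass which a nonatomic finite measure gives to `Ioc a x` takes every intermediate value. -/
lemma exists_measureReal_Ioc_eq (μ : Measure ℝ) [IsFiniteMeasure μ] [NullSingletonClass μ] {a b v : ℝ}
    (hab : a ≤ b) (hv : 0 ≤ v) (hvb : v ≤ μ.real (Set.Ioc a b)) :
    ∃ c ∈ Set.Icc a b, μ.real (Set.Ioc a c) = v := by
  have hcont : Continuous fun x => ∫ _ in a..x, (1 : ℝ) ∂μ :=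
    intervalIntegral.continuous_primitive (fun _ _ => intervalIntegrable_const) a
  have heq : ∀ x, a ≤ x → ∫ _ in a..x, (1 : ℝ) ∂μ = μ.real (Set.Ioc a x) := fun x hx => by
    rw [intervalIntegral.integral_of_le hx]
    simp
  obtain ⟨c, hc, hcv⟩ := intermediate_value_Icc hab hcont.continuousOn
    (show v ∈ Set.Icc _ _ from ⟨by simpa using hv, by simpa [heq b hab] using hvb⟩)
  exact ⟨c, hc, by rw [← heq c hc.1]; exact hcv⟩

/-- If every agent in `s` values `Ioc a b` at least `#s` times `v i`, then `Ioc a b` contains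
disjoint intervals, one for each agent `i` in `s` and worth at least `v i` to her. -/
lemma exists_disjoint_ordConnected_measureReal_ge {ι : Type*} [DecidableEq ι] (μ : ι → Measure ℝ)
    [∀ i, IsFiniteMeasure (μ i)] [∀ i, NullSingletonClass (μ i)] {v : ι → ℝ} (hv : ∀ i, 0 ≤ v i)
    (s : Finset ι) {a b : ℝ} (hab : a ≤ b)
    (hs : ∀ i ∈ s, s.card * v i ≤ (μ i).real (Set.Ioc a b)) :
    ∃ A : ι → Set ℝ, (∀ i, A i ⊆ Set.Ioc a b) ∧ (∀ i, (A i).OrdConnected) ∧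
      (∀ i j, i ≠ j → Disjoint (A i) (A j)) ∧ ∀ i ∈ s, v i ≤ (μ i).real (A i) := by
  induction hk : s.card generalizing s a with
  | zero =>
    obtain rfl := Finset.card_eq_zero.mp hk
    exact ⟨fun _ => ∅, by simp, fun _ => Set.ordConnected_empty, by simp, by simp⟩
  | succ k ih =>
    rw [hk] at hs
    push_cast at hs
    have hcut : ∀ i, ∃ c, i ∈ s → c ∈ Set.Icc a b ∧ (μ i).real (Set.Ioc a c) = v i := by
      intro i
      by_cases hi : i ∈ s
      · obtain ⟨c, hc⟩ := exists_measureReal_Ioc_eq (μ i) hab (hv i)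
          (by nlinarith [hs i hi, mul_nonneg (Nat.cast_nonneg (α := ℝ) k) (hv i)])
        exact ⟨c, fun _ => hc⟩
      · exact ⟨a, fun h => absurd h hi⟩
    choose c hc using hcut
    obtain ⟨m, hm, hmin⟩ := s.exists_min_image c (Finset.card_pos.mp (by omega))
    obtain ⟨⟨ham, hmb⟩, hmv⟩ := hc m hm
    obtain ⟨A, hsub, hord, hdisj, hval⟩ := ih (s.erase m) hmb (by
      intro i hi
      have his := Finset.mem_of_mem_erase hi
      obtain ⟨⟨-, -⟩, hiv⟩ := hc i his
      have hle : (μ i).real (Set.Ioc a (c m)) ≤ v i :=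
        hiv ▸ measureReal_mono (Set.Ioc_subset_Ioc_right (hmin i his))
      have hsplit : (μ i).real (Set.Ioc a b)
          = (μ i).real (Set.Ioc a (c m)) + (μ i).real (Set.Ioc (c m) b) := by
        rw [← Set.Ioc_union_Ioc_eq_Ioc ham hmb]
        exact measureReal_union (Set.Ioc_disjoint_Ioc_of_le le_rfl) measurableSet_Ioc
      rw [Finset.card_erase_of_mem hm, hk, Nat.add_sub_cancel]
      linarith [hs i his]) (by rw [Finset.card_erase_of_mem hm, hk, Nat.add_sub_cancel])
    have hm_disj : ∀ j, Disjoint (Set.Ioc a (c m)) (A j) := fun j =>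
      (Set.Ioc_disjoint_Ioc_of_le le_rfl).mono_right (hsub j)
    refine ⟨Function.update A m (Set.Ioc a (c m)), fun i => ?_, fun i => ?_, fun i j hij => ?_,
      fun i hi => ?_⟩
    · rcases eq_or_ne i m with rfl | him
      · simpa using Set.Ioc_subset_Ioc_right hmb
      · simpa [him] using (hsub i).trans (Set.Ioc_subset_Ioc_left ham)
    · rcases eq_or_ne i m with rfl | him
      · simpa using Set.ordConnected_Ioc
      · simpa [him] using hord i
    · rcases eq_or_ne i m with rfl | him
      · simpa [hij.symm] using hm_disj j
      · rcases eq_or_ne j m with rfl | hjm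
        · simpa [him] using (hm_disj i).symm
        · simpa [him, hjm] using hdisj i j hij
    · rcases eq_or_ne i m with rfl | him
      · simpa using hmv.ge
      · simpa [him] using hval i (Finset.mem_erase.mpr ⟨him, hi⟩)

/-- The least valuable of `n` disjoint pieces is worth at most a proportional share. -/
lemma iInf_measureReal_le_div {n : ℕ} (hn : 1 ≤ n) (μ : Measure ℝ) [IsFiniteMeasure μ]
    {P : Fin n → Set ℝ} (hP : ∀ j, IsIntervalPiece (P j))
    (hdisj : ∀ j j' : Fin n, j ≠ j' → P j ∩ P j' = ∅) :
    ⨅ j, μ.real (P j) ≤ μ.real (Set.Icc 0 1) / n := by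
  rw [le_div_iff₀ (by exact_mod_cast hn)]
  calc (⨅ j, μ.real (P j)) * n = ∑ _ : Fin n, ⨅ j, μ.real (P j) := by simp [mul_comm]
    _ ≤ ∑ j, μ.real (P j) := Finset.sum_le_sum fun j _ =>
        ciInf_le (Set.finite_range _).bddBelow j
    _ = μ.real (⋃ j, P j) := (measureReal_iUnion_fintype
        (fun i j hij => Set.disjoint_iff_inter_eq_empty.mpr (hdisj i j hij))
        fun j => (hP j).2.measurableSet).symm
    _ ≤ μ.real (Set.Icc 0 1) := measureReal_mono (Set.iUnion_subset fun j => (hP j).1)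

/-- STATEMENT 15: For `n ≥ 1` agents with finite nonatomic Borel measures on ℝ, there is
a family of pairwise disjoint pieces of `[0,1]` (the empty-intersection setting) giving
every agent at least her maximin share `MMS_i = sup` over families of pairwise disjoint
pieces `(P_1,…,P_n)` of `min_j μ_i(P_j)`. -/
theorem maximin_allocation_exists_interval_disjoint
    (n : ℕ) (hn : 1 ≤ n)
    (μ : Fin n → Measure ℝ) (hfin : ∀ i, IsFiniteMeasure (μ i))
    (hna : ∀ i (x : ℝ), μ i {x} = 0) :
    ∃ A : Fin n → Set ℝ,
      (∀ i, IsIntervalPiece (A i)) ∧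
      (∀ i j : Fin n, i ≠ j → A i ∩ A j = ∅) ∧
      ∀ i : Fin n,
        sSup {t : ℝ | ∃ P : Fin n → Set ℝ,
            (∀ j, IsIntervalPiece (P j)) ∧
            (∀ j j' : Fin n, j ≠ j' → P j ∩ P j' = ∅) ∧
            t = ⨅ j : Fin n, (μ i (P j)).toReal}
          ≤ (μ i (A i)).toReal := by
  have (i : Fin n) : NullSingletonClass (μ i) := ⟨hna i⟩
  have hn0 : (n : ℝ) ≠ 0 := by positivity
  obtain ⟨A, hsub, hord, hdisj, hval⟩ := exists_disjoint_ordConnected_measureReal_ge μ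
    (v := fun i => (μ i).real (Set.Ioc 0 1) / n) (fun i => by positivity) Finset.univ
    zero_le_one (fun i _ => by rw [Finset.card_fin, mul_div_cancel₀ _ hn0])
  refine ⟨A, fun i => ⟨(hsub i).trans Set.Ioc_subset_Icc_self, hord i⟩,
    fun i j hij => (hdisj i j hij).inter_eq, fun i => ?_⟩
  refine Real.sSup_le ?_ ENNReal.toReal_nonneg
  rintro t ⟨P, hP, hPdisj, rfl⟩
  refine (iInf_measureReal_le_div hn (μ i) hP hPdisj).trans ?_
  rw [← measureReal_congr (Ioc_ae_eq_Icc (μ := μ i))]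
  exact hval i (Finset.mem_univ i)
end
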